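/- Fix an integer c ≥ 1 and consider the disconnected snip model with arbitrarily many tools: starting from a finite collection of subsets of ℝ², each of segment-complexity at most c, new tools are created one at a time, where each snip operation chooses two already-existing tools T and U and a rigid motion g and creates the new tool U \ closure(g(T)), all created tools being kept. Then every tool created after k snip operations has segment-complexity at most c · 2^k; consequently, creating a tool of segment-complexity at least m requires at least log₂(m/c) snip operations. -/

import Mathlib

open Set

/-- The plane. -/
abbrev Plane := ℝ × ℝ

/-- A rigid motion of the plane: `g x = R x + v` with `R ∈ SO(2)`. -/
def IsRigidMotion (g : Plane → Plane) : Prop :=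
  ∃ θ : ℝ, ∃ v : Plane, ∀ p : Plane,
    g p = (Real.cos θ * p.1 - Real.sin θ * p.2 + v.1,
           Real.sin θ * p.1 + Real.cos θ * p.2 + v.2)

/-- The segment-complexity of `S ⊆ ℝ²`: the least `m` such that the frontier of `S`
is contained in a union of `m` closed line segments (`⊤` if no such `m` exists). -/
noncomputable def SegComplexity (S : Set Plane) : ℕ∞ :=
  sInf {c : ℕ∞ | ∃ m : ℕ, c = (m : ℕ∞) ∧ ∃ s : Fin m → Plane × Plane,
    frontier S ⊆ ⋃ i, segment ℝ (s i).1 (s i).2}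

/-- `SnipSeq init k create` : starting from the collection `init` of tools, the
tools `create 0, …, create (k-1)` are created in order, each snip operation taking
two already-existing tools `T` and `U` and a rigid motion `g` and creating the new
tool `U \ closure (g '' T)`; all created tools are kept. -/
def SnipSeq (init : Set (Set Plane)) (k : ℕ) (create : Fin k → Set Plane) : Prop :=
  ∀ ℓ : Fin k, ∃ T U : Set Plane,
    (T ∈ init ∨ ∃ i : Fin k, i < ℓ ∧ T = create i) ∧
    (U ∈ init ∨ ∃ i : Fin k, i < ℓ ∧ U = create i) ∧
    ∃ g : Plane → Plane, IsRigidMotion g ∧ create ℓ = U \ closure (g '' T)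

lemma segComplexity_le_of_frontier_subset {S : Set Plane} {n : ℕ} (s : Fin n → Plane × Plane)
    (h : frontier S ⊆ ⋃ i, segment ℝ (s i).1 (s i).2) : SegComplexity S ≤ n :=
  sInf_le ⟨n, rfl, s, h⟩

lemma exists_segments_of_segComplexity_ne_top {S : Set Plane} (h : SegComplexity S ≠ ⊤) :
    ∃ m : ℕ, SegComplexity S = m ∧ ∃ s : Fin m → Plane × Plane,
      frontier S ⊆ ⋃ i, segment ℝ (s i).1 (s i).2 := by
  refine csInf_mem (s := {c : ℕ∞ | ∃ m : ℕ, c = (m : ℕ∞) ∧ ∃ s : Fin m → Plane × Plane,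
    frontier S ⊆ ⋃ i, segment ℝ (s i).1 (s i).2}) ?_
  rw [Set.nonempty_iff_ne_empty]
  intro h_empty
  exact h (by rw [SegComplexity, h_empty, sInf_empty])

lemma IsRigidMotion.exists_homeomorph {g : Plane → Plane} (hg : IsRigidMotion g) :
    ∃ e : Plane ≃ₜ Plane, ⇑e = g := by
  obtain ⟨θ, v, h⟩ := hg
  have hθ := Real.sin_sq_add_cos_sq θ
  refine ⟨⟨⟨g, fun p => (Real.cos θ * (p.1 - v.1) + Real.sin θ * (p.2 - v.2),
    -Real.sin θ * (p.1 - v.1) + Real.cos θ * (p.2 - v.2)), fun p => ?_, fun p => ?_⟩, ?_, ?_⟩, rfl⟩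
  · ext
    · simp only [h]
      linear_combination p.1 * hθ
    · simp only [h]
      linear_combination p.2 * hθ
  · ext
    · simp only [h]
      linear_combination (p.1 - v.1) * hθ
    · simp only [h]
      linear_combination (p.2 - v.2) * hθ
  · change Continuous g
    rw [funext h]
    fun_prop
  · change Continuous fun p : Plane => (Real.cos θ * (p.1 - v.1) + Real.sin θ * (p.2 - v.2),
      -Real.sin θ * (p.1 - v.1) + Real.cos θ * (p.2 - v.2))
    fun_prop

lemma IsRigidMotion.mapsTo_segment {g : Plane → Plane} (hg : IsRigidMotion g) (x y : Plane) :
    MapsTo g (segment ℝ x y) (segment ℝ (g x) (g y)) := by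
  obtain ⟨θ, v, h⟩ := hg
  rintro _ ⟨a, b, ha, hb, hab, rfl⟩
  refine ⟨a, b, ha, hb, hab, ?_⟩
  ext
  · simp only [h, Prod.fst_add, Prod.snd_add, Prod.smul_fst, Prod.smul_snd, smul_eq_mul]
    linear_combination v.1 * hab
  · simp only [h, Prod.fst_add, Prod.snd_add, Prod.smul_fst, Prod.smul_snd, smul_eq_mul]
    linear_combination v.2 * hab

lemma frontier_diff_closure_subset {X : Type*} [TopologicalSpace X] (U V : Set X) :
    frontier (U \ closure V) ⊆ frontier U ∪ frontier V := by
  rw [sdiff_eq]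
  refine (frontier_inter_subset _ _).trans (union_subset_union inter_subset_left ?_)
  rw [frontier_compl]
  exact inter_subset_right.trans frontier_closure_subset

lemma segComplexity_diff_closure_image_le {g : Plane → Plane} (hg : IsRigidMotion g)
    (T U : Set Plane) :
    SegComplexity (U \ closure (g '' T)) ≤ SegComplexity U + SegComplexity T := by
  by_cases hU : SegComplexity U = ⊤
  · simp [hU]
  by_cases hT : SegComplexity T = ⊤
  · simp [hT]
  obtain ⟨m, hm, s, hs⟩ := exists_segments_of_segComplexity_ne_top hU
  obtain ⟨n, hn, t, ht⟩ := exists_segments_of_segComplexity_ne_top hT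
  rw [hm, hn, ← Nat.cast_add]
  refine segComplexity_le_of_frontier_subset
    (Fin.append s fun i => (g (t i).1, g (t i).2)) fun p hp => ?_
  rw [mem_iUnion]
  rcases frontier_diff_closure_subset _ _ hp with hp | hp
  · obtain ⟨i, hi⟩ := mem_iUnion.1 (hs hp)
    exact ⟨Fin.castAdd n i, by simpa using hi⟩
  · obtain ⟨e, rfl⟩ := hg.exists_homeomorph
    rw [← e.image_frontier] at hp
    obtain ⟨q, hq, rfl⟩ := hp
    obtain ⟨i, hi⟩ := mem_iUnion.1 (ht hq)
    exact ⟨Fin.natAdd m i, by simpa using hg.mapsTo_segment _ _ hi⟩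

lemma SnipSeq.segComplexity_le {c : ℕ∞} {init : Set (Set Plane)}
    (hinit : ∀ S ∈ init, SegComplexity S ≤ c) {k : ℕ} {create : Fin k → Set Plane}
    (hseq : SnipSeq init k create) (ℓ : Fin k) :
    SegComplexity (create ℓ) ≤ c * 2 ^ (ℓ.val + 1) := by
  induction ℓ using WellFoundedLT.induction with
  | ind ℓ ih =>
    have h_old : ∀ S : Set Plane, (S ∈ init ∨ ∃ i : Fin k, i < ℓ ∧ S = create i) →
        SegComplexity S ≤ c * 2 ^ ℓ.val := by
      rintro S (hS | ⟨i, hi, rfl⟩)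
      · exact (hinit S hS).trans (le_mul_of_one_le_right' (one_le_pow₀ one_le_two))
      · exact (ih i hi).trans (mul_le_mul_right (pow_le_pow_right₀ one_le_two hi) c)
    obtain ⟨T, U, hT, hU, g, hg, h⟩ := hseq ℓ
    rw [h]
    calc SegComplexity (U \ closure (g '' T))
        ≤ SegComplexity U + SegComplexity T := segComplexity_diff_closure_image_le hg T U
      _ ≤ c * 2 ^ ℓ.val + c * 2 ^ ℓ.val := add_le_add (h_old U hU) (h_old T hT)
      _ = c * 2 ^ (ℓ.val + 1) := by ring

theorem stmt6 (c : ℕ) (hc : 1 ≤ c) (init : Set (Set Plane)) (hfin : init.Finite)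
    (hinit : ∀ S ∈ init, SegComplexity S ≤ (c : ℕ∞))
    (k : ℕ) (create : Fin k → Set Plane) (hseq : SnipSeq init k create) :
    (∀ ℓ : Fin k, SegComplexity (create ℓ) ≤ (c : ℕ∞) * 2 ^ k) ∧
    (∀ (m : ℕ) (ℓ : Fin k), (m : ℕ∞) ≤ SegComplexity (create ℓ) →
      Real.logb 2 ((m : ℝ) / (c : ℝ)) ≤ (k : ℝ)) := by
  have hk : ∀ ℓ : Fin k, SegComplexity (create ℓ) ≤ (c : ℕ∞) * 2 ^ k := fun ℓ =>
    (hseq.segComplexity_le hinit ℓ).trans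
      (mul_le_mul_right (pow_le_pow_right₀ one_le_two ℓ.isLt) _)
  refine ⟨hk, fun m ℓ hm => ?_⟩
  have hmk : m ≤ c * 2 ^ k := by exact_mod_cast hm.trans (hk ℓ)
  have hc0 : (0 : ℝ) < c := by exact_mod_cast hc
  rcases m.eq_zero_or_pos with rfl | hm0
  · simp
  · have hm0' : (0 : ℝ) < m := by exact_mod_cast hm0
    rw [Real.logb_le_iff_le_rpow one_lt_two (div_pos hm0' hc0), Real.rpow_natCast,
      div_le_iff₀' hc0]
    exact_mod_cast hmk
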